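/- Let g : V → W be three times Fréchet differentiable with ‖D²g(x)‖ ≤ M and ‖D³g(x)‖ ≤ M for all x ∈ V. Then there is a constant C, depending only on M, such that for all a, b, c, d ∈ V: ‖g(a) − g(b) − Dg(b)(a − b) − g(c) + g(d) + Dg(d)(c − d)‖ ≤ C( max(‖a − c‖, ‖b − d‖) · ‖a − b‖² + (‖a − b‖ + ‖c − d‖) · ‖(a − b) − (c − d)‖ ). -/

import Mathlib

set_option maxSynthPendingDepth 3

theorem stmt_14 {V W : Type*} [NormedAddCommGroup V] [NormedSpace ℝ V]
    [NormedAddCommGroup W] [NormedSpace ℝ W] (M : ℝ) (hM : 0 < M) :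
    ∃ C : ℝ, ∀ g : V → W, Differentiable ℝ g → Differentiable ℝ (fderiv ℝ g) →
      Differentiable ℝ (fderiv ℝ (fderiv ℝ g)) →
      (∀ x : V, ‖fderiv ℝ (fderiv ℝ g) x‖ ≤ M) →
      (∀ x : V, ‖fderiv ℝ (fderiv ℝ (fderiv ℝ g)) x‖ ≤ M) →
      ∀ a b c e : V,
        ‖g a - g b - fderiv ℝ g b (a - b) - g c + g e + fderiv ℝ g e (c - e)‖ ≤
          C * (max ‖a - c‖ ‖b - e‖ * ‖a - b‖ ^ 2 +
            (‖a - b‖ + ‖c - e‖) * ‖(a - b) - (c - e)‖) := by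
  refine ⟨M, fun g h1 h2 h3 hb2 hb3 a b c e => ?_⟩
  obtain ⟨h, rfl⟩ : ∃ h, a = b + h := ⟨a - b, by abel⟩
  obtain ⟨k, rfl⟩ : ∃ k, c = e + k := ⟨c - e, by abel⟩
  simp only [add_sub_cancel_left]
  set m := max ‖b + h - (e + k)‖ ‖b - e‖ with hm
  have lip1 : ∀ x y, ‖fderiv ℝ g x - fderiv ℝ g y‖ ≤ M * ‖x - y‖ := fun x y =>
    Convex.norm_image_sub_le_of_norm_fderiv_le (fun z _ => h2 z) (fun z _ => hb2 z)
      convex_univ (Set.mem_univ y) (Set.mem_univ x)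
  have lip2 : ∀ x y, ‖fderiv ℝ (fderiv ℝ g) x - fderiv ℝ (fderiv ℝ g) y‖ ≤ M * ‖x - y‖ :=
    fun x y =>
    Convex.norm_image_sub_le_of_norm_fderiv_le (fun z _ => h3 z) (fun z _ => hb3 z)
      convex_univ (Set.mem_univ y) (Set.mem_univ x)
  have line : ∀ (p q : V) (t : ℝ), HasDerivAt (fun s : ℝ => p + s • q) q t := fun p q t => by
    simpa using ((hasDerivAt_id t).smul_const q).const_add p
  have dist : ∀ s ∈ Set.Icc (0:ℝ) 1, ‖(b + s • h) - (e + s • k)‖ ≤ m := by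
    intro s hs
    have : (b + s • h) - (e + s • k) = s • (b + h - (e + k)) + (1 - s) • (b - e) := by
      module
    rw [this]
    refine (norm_add_le _ _).trans ?_
    rw [norm_smul, norm_smul, Real.norm_of_nonneg hs.1, Real.norm_of_nonneg (by linarith [hs.2])]
    have i1 : ‖b + h - (e + k)‖ ≤ m := le_max_left _ _
    have i2 : ‖b - e‖ ≤ m := le_max_right _ _
    nlinarith [mul_le_mul_of_nonneg_left i1 hs.1,
      mul_le_mul_of_nonneg_left i2 (sub_nonneg.2 hs.2)]
  have hm0 : 0 ≤ m := (norm_nonneg _).trans (le_max_right _ _)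
  have key : ∀ t ∈ Set.Icc (0:ℝ) 1,
      ‖(fderiv ℝ g (b + t • h) - fderiv ℝ g (e + t • k)) - (fderiv ℝ g b - fderiv ℝ g e)‖ ≤
        M * m * ‖h‖ + M * ‖h - k‖ := by
    intro t ht
    have hd : ∀ s : ℝ, HasDerivAt
        (fun s : ℝ => fderiv ℝ g (b + s • h) - fderiv ℝ g (e + s • k))
        (fderiv ℝ (fderiv ℝ g) (b + s • h) h - fderiv ℝ (fderiv ℝ g) (e + s • k) k) s := fun s =>
      ((h2 _).hasFDerivAt.comp_hasDerivAt s (line b h s)).sub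
        ((h2 _).hasFDerivAt.comp_hasDerivAt s (line e k s))
    have := norm_image_sub_le_of_norm_deriv_le_segment' (a := 0) (b := 1)
      (C := M * m * ‖h‖ + M * ‖h - k‖)
      (fun s _ => (hd s).hasDerivWithinAt) (fun s hs => ?_) t ht
    · simp only [zero_smul, add_zero, sub_zero] at this
      refine this.trans (mul_le_of_le_one_right (by positivity) ht.2)
    · have e1 : fderiv ℝ (fderiv ℝ g) (b + s • h) h - fderiv ℝ (fderiv ℝ g) (e + s • k) k
          = (fderiv ℝ (fderiv ℝ g) (b + s • h) - fderiv ℝ (fderiv ℝ g) (e + s • k)) h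
            + fderiv ℝ (fderiv ℝ g) (e + s • k) (h - k) := by
        rw [ContinuousLinearMap.sub_apply, map_sub]; abel
      rw [e1]
      refine (norm_add_le _ _).trans (add_le_add ?_ ?_)
      · refine ContinuousLinearMap.le_of_opNorm_le _ ((lip2 _ _).trans ?_) h
        exact mul_le_mul_of_nonneg_left (dist s ⟨hs.1, hs.2.le⟩) hM.le
      · exact ContinuousLinearMap.le_of_opNorm_le _ (hb2 _) _
  have hd : ∀ s : ℝ, HasDerivAt
      (fun s : ℝ => (g (b + s • h) - g (e + s • k)) - s • (fderiv ℝ g b h - fderiv ℝ g e k))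
      ((fderiv ℝ g (b + s • h) h - fderiv ℝ g (e + s • k) k)
        - (1:ℝ) • (fderiv ℝ g b h - fderiv ℝ g e k)) s := fun s =>
    (((h1 _).hasFDerivAt.comp_hasDerivAt s (line b h s)).sub
      ((h1 _).hasFDerivAt.comp_hasDerivAt s (line e k s))).sub
      ((hasDerivAt_id s).smul_const _)
  have fin := norm_image_sub_le_of_norm_deriv_le_segment_01'
    (C := (M * m * ‖h‖ + M * ‖h - k‖) * ‖h‖ + M * ‖k‖ * ‖h - k‖)
    (fun s _ => (hd s).hasDerivWithinAt) (fun s hs => ?_)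
  · simp only [zero_smul, add_zero, sub_zero, one_smul] at fin
    calc _ = ‖g (b + h) - g (e + k) - (fderiv ℝ g b h - fderiv ℝ g e k) - (g b - g e)‖ := by
          congr 1; abel
      _ ≤ _ := fin
      _ = _ := by ring
  · have e1 : (fderiv ℝ g (b + s • h) h - fderiv ℝ g (e + s • k) k)
        - (1:ℝ) • (fderiv ℝ g b h - fderiv ℝ g e k)
        = ((fderiv ℝ g (b + s • h) - fderiv ℝ g (e + s • k))
            - (fderiv ℝ g b - fderiv ℝ g e)) h
          + (fderiv ℝ g (e + s • k) - fderiv ℝ g e) (h - k) := by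
      simp only [ContinuousLinearMap.sub_apply, map_sub, one_smul]; abel
    have hs' : s ∈ Set.Icc (0:ℝ) 1 := ⟨hs.1, hs.2.le⟩
    rw [e1]
    refine (norm_add_le _ _).trans (add_le_add ?_ ?_)
    · exact ContinuousLinearMap.le_of_opNorm_le _ (key s hs') h
    · refine ContinuousLinearMap.le_of_opNorm_le _ ((lip1 _ _).trans ?_) _
      rw [add_sub_cancel_left, norm_smul, Real.norm_of_nonneg hs.1]
      exact mul_le_mul_of_nonneg_left (mul_le_of_le_one_left (norm_nonneg _) hs.2.le) hM.le
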